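/- arXiv:1409.7957 — 3 statements merged into one kernel-verified Lean document; each statement's English description precedes it below -/
import Mathlib

section
/- The power series A = Σ_{n≥0} a_n u^{−2n} y^{3n} satisfies S_y² A = y^{−2} A as an identity of formal Laurent series in y over K. -/
noncomputable section

/-- The base field `K = ℂ(u)`, rational functions in the variable `u`. -/
abbrev K : Type := RatFunc ℂ

/-- The variable `u ∈ K`. -/
def u : K := RatFunc.X

/-- The formal derivative `∂_y` of a formal Laurent series in `y` over `K`. -/
def derivLS (f : LaurentSeries K) : LaurentSeries K where
  coeff := fun n => ((n + 1 : ℤ) : K) * f.coeff (n + 1)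
  isPWO_support' := by
    refine ((f.isPWO_support.add (Set.isPWO_singleton (-1 : ℤ))).mono ?_)
    intro n hn
    simp only [Function.mem_support, ne_eq] at hn
    have hf : f.coeff (n + 1) ≠ 0 := fun h => hn (by simp [h])
    rw [Set.add_singleton]
    exact ⟨n + 1, by simpa [HahnSeries.mem_support] using hf, by ring⟩

/-- Multiplication of a formal Laurent series by `y^k`. -/
def ySh (k : ℤ) (f : LaurentSeries K) : LaurentSeries K :=
  (HahnSeries.single k (1 : K)) * f

/-- The operator `S_y f = u⁻² y³ ∂_y f + (1/2) u⁻² y² f + y⁻¹ f`. -/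
def Sy (f : LaurentSeries K) : LaurentSeries K :=
  (u⁻¹ ^ 2) • ySh 3 (derivLS f) + ((1 / 2 : K) * u⁻¹ ^ 2) • ySh 2 f + ySh (-1) f

/-- `a_n = (-1)^n (6n)! / (288^n (2n)! (3n)!)`. -/
def aQ (n : ℕ) : ℚ :=
  (-1) ^ n * ((6 * n).factorial : ℚ) /
    (288 ^ n * ((2 * n).factorial : ℚ) * ((3 * n).factorial : ℚ))

/-- The power-series-in-`y` `Σ_{n ≥ 0} c_n u^{-2n} y^{3n}` (viewed as a Laurent series)
attached to rational coefficients `c : ℕ → ℚ`. -/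
def mkS (c : ℕ → ℚ) : LaurentSeries K :=
  HahnSeries.ofPowerSeries ℤ K
    (PowerSeries.mk fun m => if 3 ∣ m then ((c (m / 3) : ℚ) : K) * u⁻¹ ^ (2 * (m / 3)) else 0)

/-- The series `A = Σ_{n ≥ 0} a_n u^{-2n} y^{3n}`. -/
def A : LaurentSeries K := mkS aQ

theorem coeff_ySh (k n : ℤ) (f : LaurentSeries K) : (ySh k f).coeff n = f.coeff (n - k) := by
  rw [ySh, HahnSeries.coeff_single_mul, one_mul]

theorem coeff_Sy (f : LaurentSeries K) (n : ℤ) :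
    (Sy f).coeff n = u⁻¹ ^ 2 * ((n : K) - 3 / 2) * f.coeff (n - 2) + f.coeff (n + 1) := by
  have h : n - 3 + 1 = n - 2 := by ring
  simp only [Sy, HahnSeries.coeff_add, HahnSeries.coeff_smul, coeff_ySh, derivLS, smul_eq_mul, h,
    sub_neg_eq_add]
  push_cast
  ring

theorem aQ_succ (k : ℕ) :
    6 * ((k : ℚ) + 1) * aQ (k + 1) = -((3 * k + 5 / 2) * (3 * k + 1 / 2)) * aQ k := by
  have h2 : ((2 * k).factorial : ℚ) ≠ 0 := by positivity
  have h3 : ((3 * k).factorial : ℚ) ≠ 0 := by positivity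
  simp only [aQ, show 6 * (k + 1) = 6 * k + 1 + 1 + 1 + 1 + 1 + 1 by ring,
    show 2 * (k + 1) = 2 * k + 1 + 1 by ring, show 3 * (k + 1) = 3 * k + 1 + 1 + 1 by ring,
    Nat.factorial_succ]
  push_cast
  field_simp
  ring

theorem coeff_mkS_of_neg (c : ℕ → ℚ) {m : ℤ} (hm : m < 0) : (mkS c).coeff m = 0 := by
  rw [mkS, HahnSeries.ofPowerSeries_apply]
  refine HahnSeries.embDomain_of_notMem_range ?_
  rintro ⟨k, hk⟩
  have : (k : ℤ) = m := hk
  lia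

theorem coeff_mkS_natCast (c : ℕ → ℚ) (m : ℕ) :
    (mkS c).coeff (m : ℤ) =
      if 3 ∣ m then ((c (m / 3) : ℚ) : K) * u⁻¹ ^ (2 * (m / 3)) else 0 := by
  rw [mkS, HahnSeries.ofPowerSeries_apply_coeff, PowerSeries.coeff_mk]

theorem coeff_A_recurrence (m : ℤ) :
    u⁻¹ ^ 2 * (((m : K) - 1 / 2) * ((m : K) - 5 / 2)) * A.coeff (m - 3)
      + 2 * (m : K) * A.coeff m = 0 := by
  unfold A
  by_cases hm : m < 3
  · rw [coeff_mkS_of_neg aQ (by lia : m - 3 < 0), mul_zero, zero_add]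
    by_cases hneg : m < 0
    · rw [coeff_mkS_of_neg aQ hneg, mul_zero]
    lift m to ℕ using by lia
    rw [coeff_mkS_natCast]
    split_ifs with hd
    · obtain rfl : m = 0 := by lia
      simp
    · rw [mul_zero]
  · obtain ⟨j, rfl⟩ : ∃ j : ℕ, m = ((j + 3 : ℕ) : ℤ) := ⟨(m - 3).toNat, by lia⟩
    rw [show ((j + 3 : ℕ) : ℤ) - 3 = (j : ℤ) by lia, coeff_mkS_natCast, coeff_mkS_natCast]
    by_cases hd : 3 ∣ j
    · obtain ⟨k, rfl⟩ := hd
      have h := congrArg (Rat.cast : ℚ → K) (aQ_succ k)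
      push_cast at h
      rw [if_pos (by lia), if_pos (by lia), show (3 * k + 3) / 3 = k + 1 by lia,
        show 3 * k / 3 = k by lia]
      push_cast
      linear_combination u⁻¹ ^ (2 * k + 2) * h
    · rw [if_neg hd, if_neg (by lia)]
      simp

/-- The series `A = Σ_{n≥0} a_n u^{-2n} y^{3n}` satisfies `S_y² A = y⁻² A`
as formal Laurent series in `y` over `K`. -/
theorem stmt0 : Sy (Sy A) = ySh (-2) A := by
  ext n
  have h := coeff_A_recurrence (n - 1)
  rw [show n - 1 - 3 = n - 4 by ring] at h
  push_cast at h
  simp only [coeff_Sy, coeff_ySh]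
  rw [show n - 2 - 2 = n - 4 by ring, show n - 2 + 1 = n - 1 by ring,
    show n + 1 - 2 = n - 1 by ring, show n + 1 + 1 = n + 2 by ring,
    show n - -2 = n + 2 by ring]
  push_cast
  linear_combination u⁻¹ ^ 2 * h

end
end

section
/- For every integer n ≥ 1 the identity of rational numbers d_n = (3n − 3/2) d_{n−1} + |a_n| holds. -/
noncomputable section

/-- `d_n = Σ_{i=0}^n 3^i |a_{n-i}| ∏_{k=1}^i (n + 1/2 - k)`. -/
def dQ (n : ℕ) : ℚ :=
  ∑ i ∈ Finset.range (n + 1),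
    3 ^ i * |aQ (n - i)| * ∏ k ∈ Finset.Icc 1 i, ((n : ℚ) + 1 / 2 - (k : ℚ))

/-- Shifting `x` by one in a product of consecutive linear factors splits off the factor `x`. -/
lemma prod_Icc_add_one_sub_natCast {R : Type*} [CommRing R] (x : R) (j : ℕ) :
    ∏ k ∈ Finset.Icc 1 (j + 1), (x + 1 - (k : R)) = x * ∏ k ∈ Finset.Icc 1 j, (x - (k : R)) := by
  induction j with
  | zero => simp
  | succ j ih =>
    rw [Finset.prod_Icc_succ_top (by omega), ih, Finset.prod_Icc_succ_top (by omega)]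
    push_cast
    ring

/-- For every `n ≥ 1` one has `d_n = (3n - 3/2) d_{n-1} + |a_n|` in `ℚ`. -/
theorem stmt3 (n : ℕ) (hn : 1 ≤ n) :
    dQ n = (3 * (n : ℚ) - 3 / 2) * dQ (n - 1) + |aQ n| := by
  obtain ⟨m, rfl⟩ : ∃ m, n = m + 1 := ⟨n - 1, by omega⟩
  rw [dQ, dQ, Finset.sum_range_succ', Nat.add_sub_cancel, Finset.mul_sum]
  congr 1
  · refine Finset.sum_congr rfl fun j _ => ?_
    have h := prod_Icc_add_one_sub_natCast ((m : ℚ) + 1 / 2) j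
    rw [show (m : ℚ) + 1 / 2 + 1 = ((m + 1 : ℕ) : ℚ) + 1 / 2 by push_cast; ring] at h
    rw [h, Nat.add_sub_add_right]
    push_cast
    ring
  · simp

end
end

section
/- For any two formal Laurent series p and q in y over K, the coefficient of y^0 in the product p · (S_y q) equals the coefficient of y^0 in the product (Ŝ_y p) · q. -/
noncomputable section

/-- The operator `Ŝ_y f = -u⁻² y³ ∂_y f - (3/2) u⁻² y² f + y⁻¹ f`. -/
def SyHat (f : LaurentSeries K) : LaurentSeries K :=
  -((u⁻¹ ^ 2) • ySh 3 (derivLS f)) - ((3 / 2 : K) * u⁻¹ ^ 2) • ySh 2 f + ySh (-1) f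

/-- The Euler operator `y ∂_y` multiplies the coefficient of `y^n` by `n`. -/
theorem coeff_ySh_one_derivLS (f : LaurentSeries K) (n : ℤ) :
    (ySh 1 (derivLS f)).coeff n = (n : K) * f.coeff n := by
  have h := HahnSeries.coeff_single_mul_add (r := (1 : K)) (x := derivLS f) (a := n - 1) (b := 1)
  simpa [ySh, derivLS] using h

theorem support_ySh_one_derivLS_subset (f : LaurentSeries K) :
    (ySh 1 (derivLS f)).support ⊆ f.support := by
  intro n hn
  rw [HahnSeries.mem_support, coeff_ySh_one_derivLS] at hn
  exact right_ne_zero_of_mul hn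

/-- The Leibniz rule for the Euler operator `y ∂_y`, coefficientwise. -/
theorem coeff_leibniz_ySh_one_derivLS (p q : LaurentSeries K) (n : ℤ) :
    (p * ySh 1 (derivLS q)).coeff n + (ySh 1 (derivLS p) * q).coeff n =
      (n : K) * (p * q).coeff n := by
  rw [HahnSeries.coeff_mul_right' q.isPWO_support (support_ySh_one_derivLS_subset q),
    HahnSeries.coeff_mul_left' p.isPWO_support (support_ySh_one_derivLS_subset p),
    HahnSeries.coeff_mul, Finset.mul_sum, ← Finset.sum_add_distrib]
  refine Finset.sum_congr rfl fun ij hij => ?_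
  have hn : ij.1 + ij.2 = n := (Finset.mem_antidiagonal.mp hij).2.2
  rw [coeff_ySh_one_derivLS, coeff_ySh_one_derivLS, ← hn]
  push_cast
  ring

theorem ySh_add (k l : ℤ) (f : LaurentSeries K) : ySh (k + l) f = ySh k (ySh l f) := by
  simp [ySh, ← mul_assoc]

theorem mul_ySh (k : ℤ) (f g : LaurentSeries K) : f * ySh k g = ySh k (f * g) :=
  mul_left_comm _ _ _

theorem ySh_mul (k : ℤ) (f g : LaurentSeries K) : ySh k f * g = ySh k (f * g) :=
  mul_assoc _ _ _

theorem coeff_ySh_zero (k : ℤ) (f : LaurentSeries K) : (ySh k f).coeff 0 = f.coeff (-k) := by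
  have h := HahnSeries.coeff_single_mul_add (r := (1 : K)) (x := f) (a := -k) (b := k)
  simpa [ySh] using h

theorem smul_eq_C_mul_laurentSeries (c : K) (f : LaurentSeries K) : c • f = HahnSeries.C c * f := by
  ext n
  exact (HahnSeries.coeff_single_zero_mul (r := c) (x := f) (a := n)).symm

theorem coeff_smul_mul_laurentSeries (c : K) (f g : LaurentSeries K) (n : ℤ) :
    (c • f * g).coeff n = c * (f * g).coeff n := by
  rw [smul_eq_C_mul_laurentSeries, mul_assoc]
  exact HahnSeries.coeff_single_zero_mul

theorem coeff_mul_smul_laurentSeries (c : K) (f g : LaurentSeries K) (n : ℤ) :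
    (f * c • g).coeff n = c * (f * g).coeff n := by
  rw [mul_comm, coeff_smul_mul_laurentSeries, mul_comm g]

theorem coeff_neg_mul_laurentSeries (f g : LaurentSeries K) (n : ℤ) :
    (-f * g).coeff n = -(f * g).coeff n :=
  congrArg (fun x : LaurentSeries K => x.coeff n) (neg_mul f g)

/-- For any two formal Laurent series `p, q` in `y` over `K`, the coefficient of `y^0` in
`p · (S_y q)` equals the coefficient of `y^0` in `(Ŝ_y p) · q`. -/
theorem stmt6 (p q : LaurentSeries K) :
    (p * Sy q).coeff 0 = (SyHat p * q).coeff 0 := by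
  have h := coeff_leibniz_ySh_one_derivLS p q (-2)
  have h3 (f : LaurentSeries K) : ySh 3 f = ySh 2 (ySh 1 f) := ySh_add 2 1 f
  simp only [Sy, SyHat, h3, mul_add, add_mul, sub_mul, HahnSeries.coeff_add, HahnSeries.coeff_sub,
    coeff_neg_mul_laurentSeries, coeff_smul_mul_laurentSeries, coeff_mul_smul_laurentSeries,
    mul_ySh 2, mul_ySh (-1), ySh_mul 2, ySh_mul (-1), coeff_ySh_zero]
  push_cast at h
  linear_combination u⁻¹ ^ 2 * h

end
end
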